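/- The canonical connection preserves the quaternionic contact structure of n_p: let pr_h denote the g_λ-orthogonal projection onto T^h = span(τ₁, …, τ_{4p}) and set Iᵢ := φᵢ ∘ pr_h for i = 1, 2, 3. Then for each j = 1, 2, 3: (1) Σ_{i=1}^{3} ([Hⱼ, Iᵢ] ⊗ Iᵢ + Iᵢ ⊗ [Hⱼ, Iᵢ]) = 0 in End(n_p) ⊗ End(n_p), and (2) Σ_{i=1}^{3} (Hⱼ(ξᵢ) ⊗ Iᵢ + ξᵢ ⊗ [Hⱼ, Iᵢ]) = 0 in n_p ⊗ End(n_p), where [·,·] is the commutator of endomorphisms. (These are the holonomy-invariance conditions expressing ∇(ΣᵢIᵢ⊗Iᵢ) = 0 and ∇(Σᵢξᵢ⊗Iᵢ) = 0.) -/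

import Mathlib

/-! Common setup: the quaternionic Heisenberg Lie algebra `n_p` of dimension `4p+3`,
realised as `ℝ^{4p+3}` with orthonormal basis `ξ₁ ξ₂ ξ₃ τ₁ … τ_{4p}`. -/

noncomputable section

open scoped BigOperators

/-- The underlying vector space of the quaternionic Heisenberg Lie algebra `n_p`. -/
abbrev NV (p : ℕ) : Type := Fin (4 * p + 3) → ℝ

/-- The inner product `g_λ` for which the standard basis is orthonormal. -/
def gIP {p : ℕ} (X Y : NV p) : ℝ := ∑ a, X a * Y a

/-- Index of the basis vector `ξ_{i+1}`, `i = 0, 1, 2`. -/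
def zI (p : ℕ) (i : Fin 3) : Fin (4 * p + 3) := ⟨i.val, by have := i.isLt; omega⟩

/-- Index of the basis vector `τ_{ip + r + 1}`, `i = 0, 1, 2, 3`, `r = 0, …, p-1`. -/
def tI (p : ℕ) (i : Fin 4) (r : Fin p) : Fin (4 * p + 3) :=
  ⟨3 + i.val * p + r.val, by
    have h1 := i.isLt; have h2 := r.isLt
    have h3 : i.val * p ≤ 3 * p := Nat.mul_le_mul_right p (by omega)
    omega⟩

/-- The basis vector `ξ_{i+1}`. -/
def xi (p : ℕ) (i : Fin 3) : NV p := Pi.single (zI p i) 1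

/-- The basis vector `τ_{ip + r + 1}`. -/
def tau (p : ℕ) (i : Fin 4) (r : Fin p) : NV p := Pi.single (tI p i r) 1

/-- The Lie bracket of `n_p`: the bilinear extension of
`[τ_r, τ_{p+r}] = [τ_{2p+r}, τ_{3p+r}] = λ ξ₁`, `[τ_r, τ_{2p+r}] = [τ_{3p+r}, τ_{p+r}] = λ ξ₂`,
`[τ_r, τ_{3p+r}] = [τ_{p+r}, τ_{2p+r}] = λ ξ₃`, all other brackets of basis vectors being zero. -/
def bracket (p : ℕ) (lam : ℝ) (X Y : NV p) : NV p :=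
  (lam * ∑ r : Fin p,
      (X (tI p 0 r) * Y (tI p 1 r) - X (tI p 1 r) * Y (tI p 0 r)
        + X (tI p 2 r) * Y (tI p 3 r) - X (tI p 3 r) * Y (tI p 2 r))) • xi p 0
  + (lam * ∑ r : Fin p,
      (X (tI p 0 r) * Y (tI p 2 r) - X (tI p 2 r) * Y (tI p 0 r)
        + X (tI p 3 r) * Y (tI p 1 r) - X (tI p 1 r) * Y (tI p 3 r))) • xi p 1
  + (lam * ∑ r : Fin p,
      (X (tI p 0 r) * Y (tI p 3 r) - X (tI p 3 r) * Y (tI p 0 r)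
        + X (tI p 1 r) * Y (tI p 2 r) - X (tI p 2 r) * Y (tI p 1 r))) • xi p 2

/-- `dη_i(X, Y) := -η_i([X, Y])`. -/
def dEta (p : ℕ) (lam : ℝ) (i : Fin 3) (X Y : NV p) : ℝ := -(bracket p lam X Y (zI p i))

/-- The three almost contact endomorphisms `φ₁, φ₂, φ₃` of `n_p`. -/
def phi (p : ℕ) : Fin 3 → NV p → NV p :=
  ![fun X => X (zI p 1) • xi p 2 - X (zI p 2) • xi p 1
      + ∑ r : Fin p, (X (tI p 0 r) • tau p 1 r - X (tI p 1 r) • tau p 0 r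
          + X (tI p 2 r) • tau p 3 r - X (tI p 3 r) • tau p 2 r),
    fun X => X (zI p 2) • xi p 0 - X (zI p 0) • xi p 2
      + ∑ r : Fin p, (X (tI p 0 r) • tau p 2 r - X (tI p 2 r) • tau p 0 r
          + X (tI p 3 r) • tau p 1 r - X (tI p 1 r) • tau p 3 r),
    fun X => X (zI p 0) • xi p 1 - X (zI p 1) • xi p 0
      + ∑ r : Fin p, (X (tI p 0 r) • tau p 3 r - X (tI p 3 r) • tau p 0 r
          + X (tI p 1 r) • tau p 2 r - X (tI p 2 r) • tau p 1 r)]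

/-- `(η_i ∧ η_j)(X, Y)`. -/
def etaWedge (p : ℕ) (i j : Fin 3) (X Y : NV p) : ℝ :=
  X (zI p i) * Y (zI p j) - Y (zI p i) * X (zI p j)

/-- The 2-forms `H₁ = -(1/λ)dη₁ + 2 η₂∧η₃`, `H₂ = -(1/λ)dη₂ - 2 η₁∧η₃`,
`H₃ = -(1/λ)dη₃ + 2 η₁∧η₂`. -/
def Hform (p : ℕ) (lam : ℝ) : Fin 3 → NV p → NV p → ℝ :=
  ![fun X Y => -(1 / lam) * dEta p lam 0 X Y + 2 * etaWedge p 1 2 X Y,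
    fun X Y => -(1 / lam) * dEta p lam 1 X Y - 2 * etaWedge p 0 2 X Y,
    fun X Y => -(1 / lam) * dEta p lam 2 X Y + 2 * etaWedge p 0 1 X Y]

/-- The 2-form `H_i` regarded as an endomorphism of `n_p` via `g_λ(H_i X, Y) = H_i(X, Y)`. -/
def Hend (p : ℕ) (lam : ℝ) (i : Fin 3) (X : NV p) : NV p :=
  fun b => Hform p lam i X (Pi.single b 1)

/-- `(η₁ ∧ η₂ ∧ η₃)(X, Y, Z)`. -/
def det3 (p : ℕ) (X Y Z : NV p) : ℝ :=
  X (zI p 0) * (Y (zI p 1) * Z (zI p 2) - Y (zI p 2) * Z (zI p 1))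
  - Y (zI p 0) * (X (zI p 1) * Z (zI p 2) - X (zI p 2) * Z (zI p 1))
  + Z (zI p 0) * (X (zI p 1) * Y (zI p 2) - X (zI p 2) * Y (zI p 1))

/-- The torsion 3-form `T = η₁∧dη₁ + η₂∧dη₂ + η₃∧dη₃ - 4λ η₁∧η₂∧η₃`. -/
def Tform (p : ℕ) (lam : ℝ) (X Y Z : NV p) : ℝ :=
  (∑ i : Fin 3,
    (X (zI p i) * dEta p lam i Y Z - Y (zI p i) * dEta p lam i X Z
      + Z (zI p i) * dEta p lam i X Y)) - 4 * lam * det3 p X Y Z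

/-- The standard basis vector `e_a` of `n_p`. -/
def basisE (p : ℕ) (a : Fin (4 * p + 3)) : NV p := Pi.single a 1

end

/-- The `g_λ`-orthogonal projection onto the horizontal subspace `T^h = span(τ₁, …, τ_{4p})`. -/
noncomputable def prh (p : ℕ) (X : NV p) : NV p :=
  X - X (zI p 0) • xi p 0 - X (zI p 1) • xi p 1 - X (zI p 2) • xi p 2

/-- `Iᵢ := φᵢ ∘ pr_h`. -/
noncomputable def Iop (p : ℕ) (i : Fin 3) (X : NV p) : NV p := phi p i (prh p X)

theorem zI_inj {p : ℕ} {i j : Fin 3} : zI p i = zI p j ↔ i = j := by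
  simp [zI, Fin.ext_iff]

theorem tI_ne_zI {p : ℕ} (a : Fin 4) (r : Fin p) (i : Fin 3) : tI p a r ≠ zI p i := by
  simp only [tI, zI, ne_eq, Fin.mk.injEq]
  omega

theorem zI_ne_tI {p : ℕ} (i : Fin 3) (a : Fin 4) (r : Fin p) : zI p i ≠ tI p a r :=
  (tI_ne_zI a r i).symm

theorem tI_inj {p : ℕ} {a b : Fin 4} {r s : Fin p} : tI p a r = tI p b s ↔ a = b ∧ r = s := by
  refine ⟨fun h => ?_, by rintro ⟨rfl, rfl⟩; rfl⟩
  have hr := r.isLt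
  have hs := s.isLt
  simp only [tI, Fin.mk.injEq] at h
  fin_cases a <;> fin_cases b <;> simp [Fin.ext_iff] at h ⊢ <;> omega

theorem NV.ext_coord {p : ℕ} {X Y : NV p} (hz : ∀ i, X (zI p i) = Y (zI p i))
    (ht : ∀ a r, X (tI p a r) = Y (tI p a r)) : X = Y := by
  funext ⟨n, hn⟩
  by_cases h3 : n < 3
  · exact hz ⟨n, h3⟩
  have hp : 0 < p := by omega
  have hq : (n - 3) / p < 4 := by
    rw [Nat.div_lt_iff_lt_mul hp]
    omega
  have h := ht ⟨(n - 3) / p, hq⟩ ⟨(n - 3) % p, Nat.mod_lt _ hp⟩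
  have e : tI p ⟨(n - 3) / p, hq⟩ ⟨(n - 3) % p, Nat.mod_lt _ hp⟩ = ⟨n, hn⟩ := by
    have := Nat.div_add_mod' (n - 3) p
    simp only [tI, Fin.mk.injEq]
    omega
  rwa [e] at h

theorem Iop_zI {p : ℕ} (i k : Fin 3) (X : NV p) : Iop p i X (zI p k) = 0 := by
  fin_cases i <;>
    simp [Iop, phi, prh, xi, tau, zI_inj, zI_ne_tI]

theorem Iop_tI {p : ℕ} (i : Fin 3) (X : NV p) (a : Fin 4) (r : Fin p) :
    Iop p i X (tI p a r) =
      ![![-X (tI p 1 r), X (tI p 0 r), -X (tI p 3 r), X (tI p 2 r)],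
        ![-X (tI p 2 r), X (tI p 3 r), X (tI p 0 r), -X (tI p 1 r)],
        ![-X (tI p 3 r), -X (tI p 2 r), X (tI p 1 r), X (tI p 0 r)]] i a := by
  fin_cases i <;> fin_cases a <;>
    simp [Iop, phi, prh, xi, tau, tI_inj, Pi.single_apply, tI_ne_zI, Finset.sum_add_distrib,
      Finset.sum_sub_distrib]

theorem Hend_zI {p : ℕ} {lam : ℝ} (j : Fin 3) (X : NV p) (k : Fin 3) :
    Hend p lam j X (zI p k) =
      ![![0, -2 * X (zI p 2), 2 * X (zI p 1)],
        ![2 * X (zI p 2), 0, -2 * X (zI p 0)],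
        ![-2 * X (zI p 1), 2 * X (zI p 0), 0]] j k := by
  fin_cases j <;> fin_cases k <;>
    simp [Hend, Hform, dEta, bracket, etaWedge, xi, zI_inj, tI_ne_zI]

/-- On horizontal coordinates `Hⱼ` agrees with `Iⱼ`. -/
theorem Hend_tI {p : ℕ} {lam : ℝ} (hlam : lam ≠ 0) (j : Fin 3) (X : NV p) (a : Fin 4)
    (r : Fin p) : Hend p lam j X (tI p a r) = Iop p j X (tI p a r) := by
  rw [Iop_tI]
  fin_cases j <;> fin_cases a <;>
    simp [Hend, Hform, dEta, bracket, etaWedge, xi, zI_inj, tI_inj, Pi.single_apply, zI_ne_tI,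
      Finset.sum_add_distrib, Finset.sum_sub_distrib, hlam]

/-- The commutators `[Hⱼ, Iᵢ]` are those of the imaginary quaternions. -/
theorem commutator_Hend_Iop {p : ℕ} {lam : ℝ} (hlam : lam ≠ 0) (j i : Fin 3) :
    (fun X => Hend p lam j (Iop p i X) - Iop p i (Hend p lam j X)) =
      ![![0, (2 : ℝ) • Iop p 2, (-2 : ℝ) • Iop p 1],
        ![(-2 : ℝ) • Iop p 2, 0, (2 : ℝ) • Iop p 0],
        ![(2 : ℝ) • Iop p 1, (-2 : ℝ) • Iop p 0, 0]] j i := by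
  funext X
  refine NV.ext_coord (fun k => ?_) (fun a r => ?_)
  · fin_cases j <;> fin_cases i <;> fin_cases k <;> simp [Hend_zI, Iop_zI]
  · fin_cases j <;> fin_cases i <;> fin_cases a <;>
      simp [Hend_tI hlam, Iop_tI] <;> ring

theorem Hend_xi {p : ℕ} {lam : ℝ} (hlam : lam ≠ 0) (j i : Fin 3) :
    Hend p lam j (xi p i) =
      ![![0, (2 : ℝ) • xi p 2, (-2 : ℝ) • xi p 1],
        ![(-2 : ℝ) • xi p 2, 0, (2 : ℝ) • xi p 0],
        ![(2 : ℝ) • xi p 1, (-2 : ℝ) • xi p 0, 0]] j i := by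
  refine NV.ext_coord (fun k => ?_) (fun a r => ?_)
  · fin_cases j <;> fin_cases i <;> fin_cases k <;>
      simp [Hend_zI, xi, zI_inj]
  · fin_cases j <;> fin_cases i <;> fin_cases a <;>
      simp [Hend_tI hlam, Iop_tI, xi, tI_ne_zI]

open TensorProduct in
/-- the canonical connection preserves the qc structure of `n_p`: for each `j`,
`Σᵢ ([Hⱼ, Iᵢ] ⊗ Iᵢ + Iᵢ ⊗ [Hⱼ, Iᵢ]) = 0` in `End(n_p) ⊗ End(n_p)` and
`Σᵢ (Hⱼ(ξᵢ) ⊗ Iᵢ + ξᵢ ⊗ [Hⱼ, Iᵢ]) = 0` in `n_p ⊗ End(n_p)`. -/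
theorem quaternionic_heisenberg_preserves_qc_structure
    (p : ℕ) (hp : 1 ≤ p) (lam : ℝ) (hlam : 0 < lam) :
    ∀ j : Fin 3,
      (∑ i : Fin 3,
          ((fun X => Hend p lam j (Iop p i X) - Iop p i (Hend p lam j X)) ⊗ₜ[ℝ] Iop p i
            + Iop p i ⊗ₜ[ℝ] (fun X => Hend p lam j (Iop p i X) - Iop p i (Hend p lam j X)))
        = (0 : (NV p → NV p) ⊗[ℝ] (NV p → NV p))) ∧
      (∑ i : Fin 3,
          (Hend p lam j (xi p i) ⊗ₜ[ℝ] Iop p i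
            + xi p i ⊗ₜ[ℝ] (fun X => Hend p lam j (Iop p i X) - Iop p i (Hend p lam j X)))
        = (0 : NV p ⊗[ℝ] (NV p → NV p))) := by
  intro j
  have hl : lam ≠ 0 := hlam.ne'
  simp only [commutator_Hend_Iop hl, Hend_xi hl, Fin.sum_univ_three]
  constructor <;> fin_cases j <;>
    simp [← TensorProduct.smul_tmul', TensorProduct.tmul_smul, TensorProduct.neg_tmul,
      TensorProduct.tmul_neg]
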